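/- arXiv:2312.02689 — 3 statements merged into one kernel-verified Lean document; each statement's English description precedes it below -/
import Mathlib

section
/- Let ℬ be a Banach space, d ∈ {1,2}, η ∈ (0,1], k ≥ 1, 𝔞_k > 0, C > 0, and let (Q_{k,c})_{c∈ℤ^d} be a family of bounded linear operators on ℬ satisfying: sup_{c∈ℤ^d} ‖Q_{k,c}‖_{ℒ(ℬ)} ≤ C 𝔞_k^{−d} and, for all a,b ∈ ℤ^d, ‖Q_{k,b−a} − Q_{k,b} − Q_{k,−a} + Q_{k,0}‖_{ℒ(ℬ)} ≤ C (|a|·|b|)^η 𝔞_k^{−d−2η}. Let β : ℤ^d → ℝ satisfy Σ_{a∈ℤ^d} (1+|a|)^η |β_a| < ∞ and Σ_{a∈ℤ^d} β_a = 0. Then the series Q̄_k := Σ_{a,b∈ℤ^d} β_a β_b Q_{k,b−a} converges absolutely in operator norm, equals Σ_{a,b∈ℤ^d} β_a β_b (Q_{k,b−a} − Q_{k,b} − Q_{k,−a} + Q_{k,0}), and satisfies ‖Q̄_k‖_{ℒ(ℬ)} ≤ C (Σ_{a∈ℤ^d} (1+|a|)^η |β_a|)² 𝔞_k^{−d−2η}.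 -/
theorem summable_norm_mul_smul_of_bounded {ι κ E : Type*} [NormedAddCommGroup E]
    [NormedSpace ℝ E] {f : ι → ℝ} {g : κ → ℝ} (hf : Summable fun i => |f i|)
    (hg : Summable fun j => |g j|) {F : ι × κ → E} {M : ℝ} (hF : ∀ p, ‖F p‖ ≤ M) :
    Summable fun p : ι × κ => ‖(f p.1 * g p.2) • F p‖ := by
  have h := (hf.mul_of_nonneg hg (fun _ => abs_nonneg _) (fun _ => abs_nonneg _)).mul_right M
  refine h.of_nonneg_of_le (fun _ => norm_nonneg _) fun p => ?_
  rw [norm_smul, Real.norm_eq_abs, abs_mul]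
  gcongr
  exact hF p

/-- If `f` sums to zero, the double series of `f i * f j` weighted by a bounded family depending on
the second index only sums to zero. -/
theorem hasSum_mul_smul_snd_of_hasSum_zero {ι E : Type*} [NormedAddCommGroup E]
    [NormedSpace ℝ E] [CompleteSpace E] {f : ι → ℝ} (hf : Summable fun i => |f i|)
    (hf0 : HasSum f 0) {R : ι → E} {M : ℝ} (hR : ∀ i, ‖R i‖ ≤ M) :
    HasSum (fun p : ι × ι => (f p.1 * f p.2) • R p.2) 0 := by
  have hR' : Summable fun i => f i • R i := by
    refine Summable.of_norm ((hf.mul_right M).of_nonneg_of_le (fun _ => norm_nonneg _) fun i => ?_)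
    rw [norm_smul, Real.norm_eq_abs]
    gcongr
    exact hR i
  have hs := (summable_norm_mul_smul_of_bounded hf hf (F := fun p : ι × ι => R p.2)
    fun p => hR p.2).of_norm
  simp only [mul_smul] at hs ⊢
  simpa using hf0.smul hR'.hasSum hs

/-- Same as `hasSum_mul_smul_snd_of_hasSum_zero`, with the family depending on the first index. -/
theorem hasSum_mul_smul_fst_of_hasSum_zero {ι E : Type*} [NormedAddCommGroup E]
    [NormedSpace ℝ E] [CompleteSpace E] {f : ι → ℝ} (hf : Summable fun i => |f i|)
    (hf0 : HasSum f 0) {R : ι → E} {M : ℝ} (hR : ∀ i, ‖R i‖ ≤ M) :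
    HasSum (fun p : ι × ι => (f p.1 * f p.2) • R p.1) 0 := by
  rw [← (Equiv.prodComm ι ι).hasSum_iff]
  simpa [Function.comp_def, mul_comm] using hasSum_mul_smul_snd_of_hasSum_zero hf hf0 hR


/-- For a family `(Q_c)_{c ∈ ℤ^d}` of bounded operators on a Banach space with
`sup_c ‖Q_c‖ ≤ C 𝔞_k^{-d}` and `‖Q_{b-a} - Q_b - Q_{-a} + Q_0‖ ≤ C (|a||b|)^η 𝔞_k^{-d-2η}`,
and `β` with `∑ (1+|a|)^η |β_a| < ∞`, `∑ β_a = 0`, the series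
`Q̄ = ∑_{a,b} β_a β_b Q_{b-a}` converges absolutely in operator norm, equals
`∑_{a,b} β_a β_b (Q_{b-a} - Q_b - Q_{-a} + Q_0)`, and
`‖Q̄‖ ≤ C (∑ (1+|a|)^η |β_a|)² 𝔞_k^{-d-2η}`. -/
theorem stmt_3
    {d : ℕ} (hd : d = 1 ∨ d = 2)
    {ℬ : Type*} [NormedAddCommGroup ℬ] [NormedSpace ℝ ℬ] [CompleteSpace ℬ]
    (η : ℝ) (hη : 0 < η ∧ η ≤ 1) (𝔞k : ℝ) (h𝔞k : 0 < 𝔞k) (C : ℝ) (hC : 0 < C)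
    (Q : (Fin d → ℤ) → (ℬ →L[ℝ] ℬ))
    (hQbd : ∀ c : Fin d → ℤ, ‖Q c‖ ≤ C * 𝔞k ^ (-(d : ℝ)))
    (hQ'' : ∀ a b : Fin d → ℤ,
      ‖Q (b - a) - Q b - Q (-a) + Q 0‖ ≤ C * (‖a‖ * ‖b‖) ^ η * 𝔞k ^ (-(d : ℝ) - 2 * η))
    (β : (Fin d → ℤ) → ℝ)
    (hβ : Summable (fun a : Fin d → ℤ => (1 + ‖a‖) ^ η * |β a|))
    (hβ0 : ∑' a, β a = 0) :
    Summable (fun p : (Fin d → ℤ) × (Fin d → ℤ) => ‖(β p.1 * β p.2) • Q (p.2 - p.1)‖) ∧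
    (∑' p : (Fin d → ℤ) × (Fin d → ℤ), (β p.1 * β p.2) • Q (p.2 - p.1)
      = ∑' p : (Fin d → ℤ) × (Fin d → ℤ),
          (β p.1 * β p.2) • (Q (p.2 - p.1) - Q p.2 - Q (-p.1) + Q 0)) ∧
    ‖∑' p : (Fin d → ℤ) × (Fin d → ℤ), (β p.1 * β p.2) • Q (p.2 - p.1)‖
      ≤ C * (∑' a : Fin d → ℤ, (1 + ‖a‖) ^ η * |β a|) ^ 2 * 𝔞k ^ (-(d : ℝ) - 2 * η) := by
  have hη0 := hη.1.le
  have habs : Summable fun a => |β a| := hβ.of_nonneg_of_le (fun _ => abs_nonneg _) fun a =>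
    le_mul_of_one_le_left (abs_nonneg _)
      (Real.one_le_rpow (le_add_of_nonneg_right (norm_nonneg a)) hη0)
  have hz : HasSum β 0 := hβ0 ▸ habs.of_abs.hasSum
  have hsum := summable_norm_mul_smul_of_bounded habs habs
    (F := fun p : (Fin d → ℤ) × (Fin d → ℤ) => Q (p.2 - p.1)) fun p => hQbd _
  have heq : HasSum (fun p : (Fin d → ℤ) × (Fin d → ℤ) =>
      (β p.1 * β p.2) • (Q (p.2 - p.1) - Q p.2 - Q (-p.1) + Q 0))
      (∑' p : (Fin d → ℤ) × (Fin d → ℤ), (β p.1 * β p.2) • Q (p.2 - p.1)) := by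
    have h2 := hasSum_mul_smul_snd_of_hasSum_zero habs hz (R := Q) hQbd
    have h1 := hasSum_mul_smul_fst_of_hasSum_zero habs hz (R := fun a => Q (-a)) fun a => hQbd _
    have h0 := hasSum_mul_smul_snd_of_hasSum_zero habs hz (R := fun _ => Q 0) fun _ => hQbd _
    simpa only [smul_add, smul_sub, sub_zero, add_zero] using
      ((hsum.of_norm.hasSum.sub h2).sub h1).add h0
  refine ⟨hsum, heq.tsum_eq.symm, ?_⟩
  have hw : ∀ a : Fin d → ℤ, 0 ≤ (1 + ‖a‖) ^ η * |β a| := fun a => by positivity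
  have hbound := ((hβ.hasSum.mul hβ.hasSum (hβ.mul_of_nonneg hβ hw hw)).mul_left C).mul_right
    (𝔞k ^ (-(d : ℝ) - 2 * η))
  rw [← heq.tsum_eq, sq]
  refine tsum_of_norm_bounded hbound fun p => ?_
  rw [norm_smul, Real.norm_eq_abs, abs_mul]
  calc |β p.1| * |β p.2| * ‖Q (p.2 - p.1) - Q p.2 - Q (-p.1) + Q 0‖
      ≤ |β p.1| * |β p.2| * (C * (‖p.1‖ * ‖p.2‖) ^ η * 𝔞k ^ (-(d : ℝ) - 2 * η)) := by
        gcongr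
        exact hQ'' p.1 p.2
    _ ≤ |β p.1| * |β p.2| *
          (C * ((1 + ‖p.1‖) * (1 + ‖p.2‖)) ^ η * 𝔞k ^ (-(d : ℝ) - 2 * η)) := by
        gcongr <;> exact le_add_of_nonneg_left zero_le_one
    _ = _ := by
        rw [Real.mul_rpow (by positivity) (by positivity)]
        ring
end

section
/- Let d ∈ {1,2} and ℬ a complex Banach space. For each t ∈ [−π,π]^d let P_t be a bounded linear operator on ℬ, with t ↦ P_t^k Bochner-integrable on [−π,π]^d for each k, and for a ∈ ℤ^d define Q_{k,a} := (2π)^{−d} ∫_{[−π,π]^d} e^{−i⟨t,a⟩} P_t^k dt (Bochner integral in ℒ(ℬ)). Let η ∈ [0,1] and suppose there exist C > 0 and a positive sequence (𝔞_k) with ∫_{[−π,π]^d} |t|^η ‖P_t^k‖_{ℒ(ℬ)} dt ≤ C 𝔞_k^{−d−η} for all k. Then there exists C' > 0 such that for all k and all a, b ∈ ℤ^d, ‖Q_{k,b} − Q_{k,a}‖_{ℒ(ℬ)} ≤ C' |b−a|^η 𝔞_k^{−d−η}. -/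
open MeasureTheory Filter Real

theorem norm_exp_neg_I_mul_sub_le (x y : ℝ) {η : ℝ} (h0 : 0 ≤ η) (h1 : η ≤ 1) :
    ‖Complex.exp (-Complex.I * (x : ℂ)) - Complex.exp (-Complex.I * (y : ℂ))‖
      ≤ 2 ^ (1 - η) * |x - y| ^ η := by
  have hunit (z : ℝ) : ‖Complex.exp (-Complex.I * (z : ℂ))‖ = 1 := by
    simp [Complex.norm_exp]
  set m := ‖Complex.exp (-Complex.I * (x : ℂ)) - Complex.exp (-Complex.I * (y : ℂ))‖ with hm
  have hm0 : 0 ≤ m := norm_nonneg _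
  have hm2 : m ≤ 2 := by
    refine (norm_sub_le _ _).trans ?_
    rw [hunit, hunit]
    norm_num
  have hmabs : m ≤ |x - y| := by
    have hfactor : Complex.exp (-Complex.I * (x : ℂ)) - Complex.exp (-Complex.I * (y : ℂ))
        = Complex.exp (-Complex.I * (y : ℂ))
          * (Complex.exp (Complex.I * ((y - x : ℝ) : ℂ)) - 1) := by
      rw [mul_sub, ← Complex.exp_add, mul_one]
      congr 2
      push_cast
      ring
    rw [hm, hfactor, norm_mul, hunit, one_mul, abs_sub_comm, ← Real.norm_eq_abs]
    exact Real.norm_exp_I_mul_ofReal_sub_one_le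
  calc m = m ^ (1 - η) * m ^ η := by
        rw [← Real.rpow_add_of_nonneg hm0 (by linarith) h0]
        simp
    _ ≤ 2 ^ (1 - η) * |x - y| ^ η := by
        have := sub_nonneg.2 h1
        gcongr

theorem abs_sum_mul_le_sqrt_mul_sqrt {ι : Type*} (s : Finset ι) (f g : ι → ℝ) :
    |∑ i ∈ s, f i * g i| ≤ √(∑ i ∈ s, f i ^ 2) * √(∑ i ∈ s, g i ^ 2) := by
  rw [← Real.sqrt_mul (Finset.sum_nonneg fun i _ => sq_nonneg (f i))]
  exact Real.abs_le_sqrt (Finset.sum_mul_sq_le_sq_mul_sq s f g)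

/-- For `Q_{k,a} = (2π)^{-d} ∫_{[-π,π]^d} e^{-i⟨t,a⟩} P_t^k dt`, the bound
`∫_{[-π,π]^d} |t|^η ‖P_t^k‖ dt ≤ C 𝔞_k^{-d-η}` implies
`‖Q_{k,b} - Q_{k,a}‖ ≤ C' |b-a|^η 𝔞_k^{-d-η}`. -/
theorem stmt_8
    {d : ℕ} (hd : d = 1 ∨ d = 2)
    {ℬ : Type*} [NormedAddCommGroup ℬ] [NormedSpace ℂ ℬ] [CompleteSpace ℬ]
    (P : (Fin d → ℝ) → (ℬ →L[ℂ] ℬ))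
    (hPint : ∀ k : ℕ, IntegrableOn (fun t => (P t) ^ k) {t : Fin d → ℝ | ‖t‖ ≤ π})
    (Q : ℕ → (Fin d → ℤ) → (ℬ →L[ℂ] ℬ))
    (hQ : ∀ (k : ℕ) (a : Fin d → ℤ), Q k a = ((2 * π) ^ d)⁻¹ •
      ∫ t in {t : Fin d → ℝ | ‖t‖ ≤ π},
        Complex.exp (-Complex.I * ((∑ i, t i * (a i : ℝ) : ℝ) : ℂ)) • (P t) ^ k)
    (η : ℝ) (hη : 0 ≤ η ∧ η ≤ 1)
    (C : ℝ) (hC : 0 < C) (𝔞 : ℕ → ℝ) (h𝔞pos : ∀ k, 0 < 𝔞 k)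
    (hint : ∀ k : ℕ,
      ∫ t in {t : Fin d → ℝ | ‖t‖ ≤ π}, Real.sqrt (∑ i, t i ^ 2) ^ η * ‖(P t) ^ k‖
        ≤ C * 𝔞 k ^ (-(d : ℝ) - η)) :
    ∃ C' : ℝ, 0 < C' ∧ ∀ (k : ℕ) (a b : Fin d → ℤ),
      ‖Q k b - Q k a‖
        ≤ C' * Real.sqrt (∑ i, ((b i - a i : ℤ) : ℝ) ^ 2) ^ η * 𝔞 k ^ (-(d : ℝ) - η) := by
  obtain ⟨h0, h1⟩ := hη
  refine ⟨((2 * π) ^ d)⁻¹ * (2 ^ (1 - η) * C), by positivity, fun k a b => ?_⟩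
  set S := {t : Fin d → ℝ | ‖t‖ ≤ π} with hS
  set r := √(∑ i, ((b i - a i : ℤ) : ℝ) ^ 2) with hr
  have hScompact : IsCompact S := by
    have hball : S = Metric.closedBall 0 π := by
      ext t
      simp [hS]
    rw [hball]
    exact isCompact_closedBall 0 π
  have hchar (c : Fin d → ℤ) : IntegrableOn (fun t : Fin d → ℝ =>
      Complex.exp (-Complex.I * ((∑ i, t i * (c i : ℝ) : ℝ) : ℂ)) • (P t) ^ k) S := by
    refine (hPint k).continuousOn_smul (Continuous.continuousOn ?_) hScompact
    fun_prop
  have hweight : IntegrableOn (fun t => √(∑ i, t i ^ 2) ^ η * ‖(P t) ^ k‖) S := by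
    refine IntegrableOn.continuousOn_mul (Continuous.continuousOn ?_) (hPint k).norm hScompact
    exact Continuous.rpow_const (by fun_prop) fun _ => Or.inr h0
  have hpoint (t : Fin d → ℝ) :
      ‖Complex.exp (-Complex.I * ((∑ i, t i * (b i : ℝ) : ℝ) : ℂ)) • (P t) ^ k
        - Complex.exp (-Complex.I * ((∑ i, t i * (a i : ℝ) : ℝ) : ℂ)) • (P t) ^ k‖
        ≤ 2 ^ (1 - η) * r ^ η * (√(∑ i, t i ^ 2) ^ η * ‖(P t) ^ k‖) := by
    have hphase : |∑ i, t i * (b i : ℝ) - ∑ i, t i * (a i : ℝ)| ≤ √(∑ i, t i ^ 2) * r := by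
      have hsum : ∑ i, t i * (b i : ℝ) - ∑ i, t i * (a i : ℝ)
          = ∑ i, t i * ((b i - a i : ℤ) : ℝ) := by
        rw [← Finset.sum_sub_distrib]
        exact Finset.sum_congr rfl fun i _ => by push_cast; ring
      rw [hsum]
      exact abs_sum_mul_le_sqrt_mul_sqrt _ _ _
    rw [← sub_smul, norm_smul]
    calc _ ≤ 2 ^ (1 - η) * |∑ i, t i * (b i : ℝ) - ∑ i, t i * (a i : ℝ)| ^ η * ‖(P t) ^ k‖ := by
          gcongr
          exact norm_exp_neg_I_mul_sub_le _ _ h0 h1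
      _ ≤ 2 ^ (1 - η) * (√(∑ i, t i ^ 2) * r) ^ η * ‖(P t) ^ k‖ := by gcongr
      _ = _ := by
          rw [Real.mul_rpow (Real.sqrt_nonneg _) (Real.sqrt_nonneg _)]
          ring
  rw [hQ, hQ, ← smul_sub, ← integral_sub (hchar b) (hchar a), norm_smul,
    Real.norm_of_nonneg (by positivity)]
  calc _ ≤ ((2 * π) ^ d)⁻¹ *
        ∫ t in S, 2 ^ (1 - η) * r ^ η * (√(∑ i, t i ^ 2) ^ η * ‖(P t) ^ k‖) := by
        gcongr
        exact norm_integral_le_of_norm_le (hweight.const_mul _) (ae_of_all _ hpoint)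
    _ ≤ ((2 * π) ^ d)⁻¹ * (2 ^ (1 - η) * r ^ η * (C * 𝔞 k ^ (-(d : ℝ) - η))) := by
        rw [integral_const_mul]
        gcongr
        exact hint k
    _ = _ := by ring
end

section
/- Let d ∈ {1,2} and ℬ a complex Banach space. For each t ∈ [−π,π]^d let P_t be a bounded linear operator on ℬ, with t ↦ P_t^k Bochner-integrable on [−π,π]^d for each k, and for a ∈ ℤ^d define Q_{k,a} := (2π)^{−d} ∫_{[−π,π]^d} e^{−i⟨t,a⟩} P_t^k dt (Bochner integral in ℒ(ℬ)). Let η ∈ [0,1] and suppose there exist C > 0 and a positive sequence (𝔞_k) with ∫_{[−π,π]^d} |t|^{2η} ‖P_t^k‖_{ℒ(ℬ)} dt ≤ C 𝔞_k^{−d−2η} for all k. Then there exists C' > 0 such that for all k and all a, b ∈ ℤ^d, ‖Q_{k,b−a} − Q_{k,b} − Q_{k,−a} + Q_{k,0}‖_{ℒ(ℬ)} ≤ C' (|a|·|b|)^η 𝔞_k^{−d−2η}. -/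
open MeasureTheory Filter Real

/-- The elementary interpolation between `‖e^{ix} - 1‖ ≤ |x|` and `‖e^{ix} - 1‖ ≤ 2`. -/
lemma norm_exp_neg_I_mul_sub_one_le_rpow {η : ℝ} (hη₀ : 0 ≤ η) (hη₁ : η ≤ 1) (x : ℝ) :
    ‖Complex.exp (-Complex.I * (x : ℂ)) - 1‖ ≤ 2 * |x| ^ η := by
  have hexp : Complex.exp (-Complex.I * (x : ℂ)) = Complex.exp (Complex.I * ((-x : ℝ) : ℂ)) := by
    push_cast; ring_nf
  rcases le_total |x| 1 with h | h
  · have hle : ‖Complex.exp (-Complex.I * (x : ℂ)) - 1‖ ≤ |x| := by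
      rw [hexp]
      simpa using Real.norm_exp_I_mul_ofReal_sub_one_le (x := -x)
    have hpow : |x| ≤ |x| ^ η := by
      simpa using Real.rpow_le_rpow_of_exponent_ge' (abs_nonneg x) h hη₀ hη₁
    linarith [abs_nonneg x]
  · have hle : ‖Complex.exp (-Complex.I * (x : ℂ)) - 1‖ ≤ 2 := by
      refine (norm_sub_le _ _).trans ?_
      rw [hexp, Complex.norm_exp_I_mul_ofReal]
      norm_num
    linarith [Real.one_le_rpow h hη₀]

lemma abs_sum_mul_le_sqrt_mul_sqrt_s9 {ι : Type*} [Fintype ι] (u v : ι → ℝ) :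
    |∑ i, u i * v i| ≤ √(∑ i, u i ^ 2) * √(∑ i, v i ^ 2) := by
  rw [← Real.sqrt_mul (Finset.sum_nonneg fun i _ => sq_nonneg (u i))]
  exact Real.abs_le_sqrt (Finset.sum_mul_sq_le_sq_mul_sq Finset.univ u v)

lemma norm_exp_second_difference_le {ι : Type*} [Fintype ι] {η : ℝ} (hη₀ : 0 ≤ η) (hη₁ : η ≤ 1)
    (t u v : ι → ℝ) :
    ‖Complex.exp (-Complex.I * ((∑ i, t i * (v i - u i) : ℝ) : ℂ))
        - Complex.exp (-Complex.I * ((∑ i, t i * v i : ℝ) : ℂ))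
        - Complex.exp (-Complex.I * ((∑ i, t i * -u i : ℝ) : ℂ)) + 1‖
      ≤ 4 * (√(∑ i, u i ^ 2) * √(∑ i, v i ^ 2)) ^ η * √(∑ i, t i ^ 2) ^ (2 * η) := by
  have hsum : ∑ i, t i * (v i - u i) = ∑ i, t i * v i + ∑ i, t i * -u i := by
    rw [← Finset.sum_add_distrib]
    exact Finset.sum_congr rfl fun i _ => by ring
  have hbound (w : ι → ℝ) : ‖Complex.exp (-Complex.I * ((∑ i, t i * w i : ℝ) : ℂ)) - 1‖
      ≤ 2 * (√(∑ i, t i ^ 2) * √(∑ i, w i ^ 2)) ^ η :=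
    (norm_exp_neg_I_mul_sub_one_le_rpow hη₀ hη₁ _).trans <| by
      gcongr
      exact abs_sum_mul_le_sqrt_mul_sqrt_s9 t w
  have hu := hbound fun i => -u i
  simp only [neg_sq] at hu
  rw [hsum, Complex.ofReal_add, mul_add, Complex.exp_add]
  calc _ = ‖(Complex.exp (-Complex.I * ((∑ i, t i * v i : ℝ) : ℂ)) - 1)
          * (Complex.exp (-Complex.I * ((∑ i, t i * -u i : ℝ) : ℂ)) - 1)‖ := by
        congr 1; ring
    _ ≤ (2 * (√(∑ i, t i ^ 2) * √(∑ i, v i ^ 2)) ^ η)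
          * (2 * (√(∑ i, t i ^ 2) * √(∑ i, u i ^ 2)) ^ η) := by
        rw [norm_mul]
        exact mul_le_mul (hbound v) hu (norm_nonneg _) (by positivity)
    _ = _ := by
        rw [Real.mul_rpow (by positivity) (by positivity),
          Real.mul_rpow (by positivity) (by positivity),
          Real.mul_rpow (by positivity) (by positivity),
          two_mul η, Real.rpow_add_of_nonneg (by positivity) hη₀ hη₀]
        ring

lemma integral_second_difference {α E : Type*} [MeasurableSpace α] {μ : Measure α}
    [NormedAddCommGroup E] [NormedSpace ℝ E] {f₁ f₂ f₃ f₄ : α → E} (h₁ : Integrable f₁ μ)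
    (h₂ : Integrable f₂ μ) (h₃ : Integrable f₃ μ) (h₄ : Integrable f₄ μ) :
    ∫ x, (f₁ x - f₂ x - f₃ x + f₄ x) ∂μ
      = ∫ x, f₁ x ∂μ - ∫ x, f₂ x ∂μ - ∫ x, f₃ x ∂μ + ∫ x, f₄ x ∂μ := by
  have h₁₂ : Integrable (fun x => f₁ x - f₂ x) μ := h₁.sub h₂
  have h₁₂₃ : Integrable (fun x => f₁ x - f₂ x - f₃ x) μ := h₁₂.sub h₃
  rw [integral_add h₁₂₃ h₄, integral_sub h₁₂ h₃, integral_sub h₁ h₂]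

/-- For `Q_{k,a} = (2π)^{-d} ∫_{[-π,π]^d} e^{-i⟨t,a⟩} P_t^k dt`, the bound
`∫_{[-π,π]^d} |t|^{2η} ‖P_t^k‖ dt ≤ C 𝔞_k^{-d-2η}` implies
`‖Q_{k,b-a} - Q_{k,b} - Q_{k,-a} + Q_{k,0}‖ ≤ C' (|a||b|)^η 𝔞_k^{-d-2η}`. -/
theorem stmt_9
    {d : ℕ} (hd : d = 1 ∨ d = 2)
    {ℬ : Type*} [NormedAddCommGroup ℬ] [NormedSpace ℂ ℬ] [CompleteSpace ℬ]
    (P : (Fin d → ℝ) → (ℬ →L[ℂ] ℬ))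
    (hPint : ∀ k : ℕ, IntegrableOn (fun t => (P t) ^ k) {t : Fin d → ℝ | ‖t‖ ≤ π})
    (Q : ℕ → (Fin d → ℤ) → (ℬ →L[ℂ] ℬ))
    (hQ : ∀ (k : ℕ) (a : Fin d → ℤ), Q k a = ((2 * π) ^ d)⁻¹ •
      ∫ t in {t : Fin d → ℝ | ‖t‖ ≤ π},
        Complex.exp (-Complex.I * ((∑ i, t i * (a i : ℝ) : ℝ) : ℂ)) • (P t) ^ k)
    (η : ℝ) (hη : 0 ≤ η ∧ η ≤ 1)
    (C : ℝ) (hC : 0 < C) (𝔞 : ℕ → ℝ) (h𝔞pos : ∀ k, 0 < 𝔞 k)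
    (hint : ∀ k : ℕ,
      ∫ t in {t : Fin d → ℝ | ‖t‖ ≤ π},
          Real.sqrt (∑ i, t i ^ 2) ^ (2 * η) * ‖(P t) ^ k‖
        ≤ C * 𝔞 k ^ (-(d : ℝ) - 2 * η)) :
    ∃ C' : ℝ, 0 < C' ∧ ∀ (k : ℕ) (a b : Fin d → ℤ),
      ‖Q k (b - a) - Q k b - Q k (-a) + Q k 0‖
        ≤ C' * (Real.sqrt (∑ i, ((a i : ℝ)) ^ 2) * Real.sqrt (∑ i, ((b i : ℝ)) ^ 2)) ^ η *
            𝔞 k ^ (-(d : ℝ) - 2 * η) := by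
  obtain ⟨hη₀, hη₁⟩ := hη
  have hbox : {t : Fin d → ℝ | ‖t‖ ≤ π} = Metric.closedBall 0 π := by
    ext t; simp
  rw [hbox] at hPint hQ hint
  have hcompact : IsCompact (Metric.closedBall (0 : Fin d → ℝ) π) := isCompact_closedBall _ _
  refine ⟨((2 * π) ^ d)⁻¹ * (4 * C), by positivity, fun k a b => ?_⟩
  have hexpint (c : Fin d → ℤ) : IntegrableOn (fun t : Fin d → ℝ =>
      Complex.exp (-Complex.I * ((∑ i, t i * (c i : ℝ) : ℝ) : ℂ)) • (P t) ^ k)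
      (Metric.closedBall 0 π) :=
    (hPint k).continuousOn_smul (by fun_prop) hcompact
  have hweight : IntegrableOn (fun t : Fin d → ℝ =>
      √(∑ i, t i ^ 2) ^ (2 * η) * ‖(P t) ^ k‖) (Metric.closedBall 0 π) := by
    refine IntegrableOn.continuousOn_mul (Continuous.continuousOn ?_) (hPint k).norm hcompact
    exact Continuous.rpow_const (by fun_prop) fun _ => Or.inr (by positivity)
  have hnorm : ‖((2 * π) ^ d)⁻¹‖ = ((2 * π) ^ d)⁻¹ := Real.norm_of_nonneg (by positivity)
  set A := (√(∑ i, (a i : ℝ) ^ 2) * √(∑ i, (b i : ℝ) ^ 2)) ^ η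
  simp only [hQ]
  rw [← smul_sub, ← smul_sub, ← smul_add, ← integral_second_difference (hexpint _) (hexpint _)
    (hexpint _) (hexpint _), norm_smul, hnorm]
  calc _ ≤ ((2 * π) ^ d)⁻¹ * ∫ t in Metric.closedBall (0 : Fin d → ℝ) π,
          4 * A * (√(∑ i, t i ^ 2) ^ (2 * η) * ‖(P t) ^ k‖) := by
        gcongr
        refine norm_integral_le_of_norm_le (hweight.const_mul (4 * A)) (ae_of_all _ fun t => ?_)
        rw [← sub_smul, ← sub_smul, ← add_smul, norm_smul, ← mul_assoc]
        gcongr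
        simpa using norm_exp_second_difference_le hη₀ hη₁ t (fun i => (a i : ℝ))
          (fun i => (b i : ℝ))
    _ ≤ ((2 * π) ^ d)⁻¹ * (4 * A * (C * 𝔞 k ^ (-(d : ℝ) - 2 * η))) := by
        rw [integral_const_mul]
        gcongr
        exact hint k
    _ = _ := by ring
end
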